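/- S·g = ρ^(1/2)·(g·cos θ − k·sin θ) and S·k = ρ^(1/2)·(g·sin θ + k·cos θ), i.e., S acts on the plane spanned by g and k as a rotation by angle θ composed with scaling by ρ^(1/2). -/

import Mathlib

noncomputable def cbrt2 : ℝ := (2 : ℝ) ^ ((1 : ℝ) / 3)
noncomputable def cbrt4 : ℝ := (2 : ℝ) ^ ((2 : ℝ) / 3)
noncomputable def ρ : ℝ := 1 + cbrt2 + cbrt4

def S : Matrix (Fin 3) (Fin 3) ℝ := !![0, 0, 1; 1, 0, -3; 0, 1, -3]

noncomputable def g : Fin 3 → ℝ :=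
  (1 / 12 : ℝ) • ![-cbrt2, 4 + 2 * cbrt2 - cbrt4, cbrt2 - cbrt4]

noncomputable def k : Fin 3 → ℝ :=
  (Real.sqrt 3 / 12) • ![cbrt2, -2 * cbrt2 - cbrt4, -cbrt2 - cbrt4]

noncomputable def θ : ℝ := Real.pi - Real.arctan (Real.sqrt 3 * cbrt2 / (2 + cbrt2))

theorem cbrt2_pos : 0 < cbrt2 := by
  unfold cbrt2; positivity

theorem cbrt2_sq : cbrt2 ^ 2 = cbrt4 := by
  unfold cbrt2 cbrt4
  rw [← Real.rpow_natCast, ← Real.rpow_mul (by norm_num)]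
  norm_num

theorem cbrt2_cube : cbrt2 ^ 3 = 2 := by
  unfold cbrt2
  rw [← Real.rpow_natCast, ← Real.rpow_mul (by norm_num)]
  norm_num

theorem ρ_pos : 0 < ρ := by
  have := cbrt2_pos
  rw [ρ, ← cbrt2_sq]
  positivity

theorem sqrt_one_add_tan_sq :
    √(1 + (√3 * cbrt2 / (2 + cbrt2)) ^ 2) = 2 * √ρ / (2 + cbrt2) := by
  have hc := cbrt2_pos
  rw [Real.sqrt_eq_iff_mul_self_eq (by positivity) (by positivity)]
  have h3 : √3 ^ 2 = (3 : ℝ) := Real.sq_sqrt (by norm_num)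
  have hρ : √ρ ^ 2 = 1 + cbrt2 + cbrt2 ^ 2 := by
    rw [Real.sq_sqrt ρ_pos.le, ρ, cbrt2_sq]
  field_simp
  rw [h3, hρ]
  ring

theorem sqrt_ρ_mul_cos_θ : √ρ * Real.cos θ = -(2 + cbrt2) / 2 := by
  have hc := cbrt2_pos
  have hρ := Real.sqrt_pos.2 ρ_pos
  rw [θ, Real.cos_pi_sub, Real.cos_arctan, sqrt_one_add_tan_sq]
  field_simp

theorem sqrt_ρ_mul_sin_θ : √ρ * Real.sin θ = √3 * cbrt2 / 2 := by
  have hc := cbrt2_pos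
  have hρ := Real.sqrt_pos.2 ρ_pos
  rw [θ, Real.sin_pi_sub, Real.sin_arctan, sqrt_one_add_tan_sq]
  field_simp

theorem S_acts_as_rotation_scaling :
    S.mulVec g = Real.sqrt ρ • (Real.cos θ • g - Real.sin θ • k) ∧
    S.mulVec k = Real.sqrt ρ • (Real.sin θ • g + Real.cos θ • k) := by
  have h3 : √3 ^ 2 = (3 : ℝ) := Real.sq_sqrt (by norm_num)
  have hc := cbrt2_cube
  rw [smul_sub, smul_add]
  simp only [smul_smul, sqrt_ρ_mul_cos_θ, sqrt_ρ_mul_sin_θ]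
  constructor
  · ext i
    fin_cases i <;> simp [S, g, k, Matrix.mulVec, dotProduct, Fin.sum_univ_three, ← cbrt2_sq] <;>
      grind
  · ext i
    fin_cases i <;> simp [S, g, k, Matrix.mulVec, dotProduct, Fin.sum_univ_three, ← cbrt2_sq] <;>
      grind
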